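/- For all v, f ∈ 𝒮(ℝ;ℂ), the pointwise commutator identity 2·𝐃̃_v(H_v f) − 2·H_v(𝐃̃_v f) = −(H_v v)·H( conj(v)·f ) + v·H( conj(H_v v)·f ) holds on ℝ, where 𝐃̃_v f := ∂ₓf + ½·v·H(conj(v)·f) and H_v f := −∂ₓₓf + ¼·|v|⁴·f − v·|D|(conj(v)·f). (This is the algebraic identity underlying the unconditional Lax pair ∂ₜ(−i𝐃̃_v) = [−iH_v, −i𝐃̃_v] along any sufficiently regular solution of the gauged Calogero–Moser DNLS, with no chirality assumption.) -/

import Mathlib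

open MeasureTheory Filter Topology

/-- The Hilbert transform, realized as a principal-value integral:
`Hf(x) = (1/π) p.v. ∫ f(y)/(x-y) dy`. -/
noncomputable def pvH (f : ℝ → ℂ) (x : ℝ) : ℂ :=
  limUnder (nhdsWithin (0 : ℝ) (Set.Ioi 0)) fun ε : ℝ =>
    (Real.pi : ℂ)⁻¹ * ∫ y in {y : ℝ | ε < |x - y|}, f y / ((x - y : ℝ) : ℂ)

/-- `𝐃̃_v f = ∂ₓf + ½ v · H(conj(v)·f)`. -/
noncomputable def DtV (v f : ℝ → ℂ) : ℝ → ℂ := fun x =>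
  deriv f x + (1 / 2) * v x * pvH (fun y => (starRingEnd ℂ) (v y) * f y) x

/-- `H_v f = −∂ₓₓf + ¼|v|⁴ f − v · |D|(conj(v)·f)`, with `|D|h = H(∂ₓh)`. -/
noncomputable def HV (v f : ℝ → ℂ) : ℝ → ℂ := fun x =>
  -deriv (deriv f) x + (1 / 4) * ((‖v x‖ ^ 4 : ℝ) : ℂ) * f x
    - v x * pvH (deriv fun y => (starRingEnd ℂ) (v y) * f y) x

open scoped SchwartzMap ComplexConjugate

/-- The Hilbert transform of a Schwartz function, written as an absolutely convergent integral. -/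
noncomputable def hilbert (h : 𝓢(ℝ, ℂ)) (x : ℝ) : ℂ :=
  (Real.pi : ℂ)⁻¹ * ∫ t in Set.Ioi (0 : ℝ), (h (x - t) - h (x + t)) / (t : ℂ)

/-- An integrable function of `t` dominating the symmetric difference quotients near `x₀`. -/
noncomputable def quotBound (x₀ t : ℝ) : ℝ :=
  (1 + t ^ 2)⁻¹ + (1 + (x₀ - t) ^ 2)⁻¹ + (1 + (x₀ + t) ^ 2)⁻¹

theorem integrable_quotBound (x₀ : ℝ) : Integrable (quotBound x₀) := by
  have h := integrable_inv_one_add_sq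
  exact (h.add (h.comp_sub_left x₀)).add (h.comp_add_left x₀)

theorem integral_quotBound (x₀ : ℝ) : ∫ t, quotBound x₀ t = 3 * Real.pi := by
  have h := integrable_inv_one_add_sq
  have h1 := h.comp_sub_left x₀
  have h2 := h.comp_add_left x₀
  unfold quotBound
  rw [integral_add (f := fun t : ℝ => (1 + t ^ 2)⁻¹ + (1 + (x₀ - t) ^ 2)⁻¹) (h.add h1) h2,
    integral_add h h1,
    integral_sub_left_eq_self (fun t : ℝ => (1 + t ^ 2)⁻¹) volume x₀,
    integral_add_left_eq_self (fun t : ℝ => (1 + t ^ 2)⁻¹) x₀, integral_univ_inv_one_add_sq]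
  ring

theorem quotBound_nonneg (x₀ t : ℝ) : 0 ≤ quotBound x₀ t := by
  unfold quotBound; positivity

theorem SchwartzMap.exists_norm_le_inv_one_add_sq (h : 𝓢(ℝ, ℂ)) :
    ∃ A, 0 ≤ A ∧ ∀ y, ‖h y‖ ≤ A * (1 + y ^ 2)⁻¹ := by
  refine ⟨SchwartzMap.seminorm ℝ 0 0 h + SchwartzMap.seminorm ℝ 2 0 h, by positivity, fun y => ?_⟩
  have h0 := SchwartzMap.norm_le_seminorm ℝ h y
  have h2 := SchwartzMap.norm_pow_mul_le_seminorm ℝ h 2 y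
  rw [Real.norm_eq_abs, sq_abs] at h2
  rw [← div_eq_mul_inv, le_div_iff₀ (by positivity)]
  nlinarith

theorem SchwartzMap.exists_norm_sub_le (h : 𝓢(ℝ, ℂ)) :
    ∃ M, 0 ≤ M ∧ ∀ x t, 0 < t → ‖h (x - t) - h (x + t)‖ ≤ M * t := by
  refine ⟨2 * SchwartzMap.seminorm ℝ 0 0 (SchwartzMap.derivCLM ℝ ℂ h), by positivity,
    fun x t ht => ?_⟩
  have := Convex.norm_image_sub_le_of_norm_deriv_le (f := h) (s := Set.univ) (x := x + t)
    (y := x - t) (C := SchwartzMap.seminorm ℝ 0 0 (SchwartzMap.derivCLM ℝ ℂ h))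
    (fun y _ => h.differentiableAt) (fun y _ => by
      simpa using SchwartzMap.norm_le_seminorm ℝ (SchwartzMap.derivCLM ℝ ℂ h) y)
    convex_univ trivial trivial
  have e : ‖x - t - (x + t)‖ = 2 * t := by
    rw [Real.norm_eq_abs, show x - t - (x + t) = -(2 * t) by ring, abs_neg,
      abs_of_pos (by linarith)]
  rw [e] at this
  linarith

theorem inv_one_add_sq_le_of_abs_sub_le {y z : ℝ} (h : |y - z| ≤ 1) :
    (1 + y ^ 2)⁻¹ ≤ 3 * (1 + z ^ 2)⁻¹ := by
  rw [← div_eq_mul_inv, inv_eq_one_div, div_le_div_iff₀ (by positivity) (by positivity)]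
  have := abs_le.1 h
  nlinarith [sq_nonneg (y + (y - z)), sq_nonneg (y - z),
    mul_nonneg (sub_nonneg.2 this.1) (sub_nonneg.2 this.2)]

theorem SchwartzMap.exists_norm_quot_le (h : 𝓢(ℝ, ℂ)) :
    ∃ C, 0 ≤ C ∧ ∀ x₀ x t, |x - x₀| ≤ 1 → 0 < t →
      ‖h (x - t) - h (x + t)‖ * t⁻¹ ≤ C * quotBound x₀ t := by
  obtain ⟨A, hA, hA'⟩ := h.exists_norm_le_inv_one_add_sq
  obtain ⟨M, hM, hM'⟩ := h.exists_norm_sub_le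
  refine ⟨2 * M + 3 * A, by positivity, fun x₀ x t hx ht => ?_⟩
  have p1 : 0 ≤ (1 + t ^ 2)⁻¹ := by positivity
  have p2 : 0 ≤ (1 + (x₀ - t) ^ 2)⁻¹ := by positivity
  have p3 : 0 ≤ (1 + (x₀ + t) ^ 2)⁻¹ := by positivity
  unfold quotBound
  rcases le_or_gt t 1 with h1 | h1
  · have q : 1 ≤ 2 * (1 + t ^ 2)⁻¹ := by
      rw [← div_eq_mul_inv, le_div_iff₀ (by positivity)]; nlinarith
    calc ‖h (x - t) - h (x + t)‖ * t⁻¹ ≤ M * t * t⁻¹ := by gcongr; exact hM' x t ht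
      _ = M := by field_simp
      _ ≤ M * (2 * (1 + t ^ 2)⁻¹) := by nlinarith
      _ ≤ _ := by nlinarith [mul_nonneg hA p1, mul_nonneg hA p2, mul_nonneg hA p3,
                    mul_nonneg hM p2, mul_nonneg hM p3]
  · calc ‖h (x - t) - h (x + t)‖ * t⁻¹ ≤ ‖h (x - t) - h (x + t)‖ * 1 := by
          gcongr; exact inv_le_one_of_one_le₀ h1.le
      _ ≤ ‖h (x - t)‖ + ‖h (x + t)‖ := by rw [mul_one]; exact norm_sub_le _ _
      _ ≤ A * (3 * (1 + (x₀ - t) ^ 2)⁻¹) + A * (3 * (1 + (x₀ + t) ^ 2)⁻¹) := by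
          gcongr
          · refine (hA' _).trans ?_
            gcongr
            exact inv_one_add_sq_le_of_abs_sub_le (by simpa using hx)
          · refine (hA' _).trans ?_
            gcongr
            exact inv_one_add_sq_le_of_abs_sub_le (by simpa using hx)
      _ ≤ _ := by nlinarith [mul_nonneg hA p1, mul_nonneg hM p1, mul_nonneg hM p2, mul_nonneg hM p3]

theorem SchwartzMap.norm_quot_eq (h : 𝓢(ℝ, ℂ)) (x : ℝ) {t : ℝ} (ht : 0 < t) :
    ‖(h (x - t) - h (x + t)) / (t : ℂ)‖ = ‖h (x - t) - h (x + t)‖ * t⁻¹ := by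
  rw [norm_div, Complex.norm_real, Real.norm_eq_abs, abs_of_pos ht, div_eq_mul_inv]

theorem SchwartzMap.continuousOn_quot (h : 𝓢(ℝ, ℂ)) (x : ℝ) :
    ContinuousOn (fun t : ℝ => (h (x - t) - h (x + t)) / (t : ℂ)) (Set.Ioi 0) := by
  have := h.continuous
  refine ContinuousOn.div (by fun_prop) (by fun_prop) fun t ht => ?_
  exact_mod_cast (ne_of_gt ht)

theorem SchwartzMap.integrableOn_quot (h : 𝓢(ℝ, ℂ)) (x : ℝ) :
    IntegrableOn (fun t : ℝ => (h (x - t) - h (x + t)) / (t : ℂ)) (Set.Ioi 0) := by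
  obtain ⟨C, hC, hC'⟩ := h.exists_norm_quot_le
  refine Integrable.mono' ((integrable_quotBound x).const_mul C).integrableOn
    ((h.continuousOn_quot x).aestronglyMeasurable measurableSet_Ioi) ?_
  filter_upwards [ae_restrict_mem measurableSet_Ioi] with t ht
  rw [h.norm_quot_eq x ht]
  exact hC' x x t (by simp) ht

theorem hasDerivAt_hilbert (h : 𝓢(ℝ, ℂ)) (x : ℝ) :
    HasDerivAt (hilbert h) (hilbert (SchwartzMap.derivCLM ℂ ℂ h) x) x := by
  obtain ⟨C, hC, hC'⟩ := (SchwartzMap.derivCLM ℂ ℂ h).exists_norm_quot_le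
  refine HasDerivAt.const_mul _ ?_
  refine (hasDerivAt_integral_of_dominated_loc_of_deriv_le (μ := volume.restrict (Set.Ioi 0))
    (F := fun x t : ℝ => (h (x - t) - h (x + t)) / (t : ℂ))
    (F' := fun x t : ℝ => ((SchwartzMap.derivCLM ℂ ℂ h) (x - t)
      - (SchwartzMap.derivCLM ℂ ℂ h) (x + t)) / (t : ℂ))
    (bound := fun t => C * quotBound x t) (Metric.ball_mem_nhds x one_pos)
    (Eventually.of_forall fun y =>
      (h.continuousOn_quot y).aestronglyMeasurable measurableSet_Ioi)
    (h.integrableOn_quot x)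
    (((SchwartzMap.derivCLM ℂ ℂ h).continuousOn_quot x).aestronglyMeasurable measurableSet_Ioi)
    ?_ ((integrable_quotBound x).const_mul C).integrableOn ?_).2
  · filter_upwards [ae_restrict_mem measurableSet_Ioi] with t ht y hy
    rw [SchwartzMap.norm_quot_eq _ y ht]
    exact hC' x y t (by simpa [Real.dist_eq] using (Metric.mem_ball.1 hy).le) ht
  · filter_upwards with t y _
    have h1 := (h.hasDerivAt (y - t)).comp_sub_const y t
    have h2 := (h.hasDerivAt (y + t)).comp_add_const y t
    simpa using (h1.sub h2).div_const (t : ℂ)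

theorem exists_norm_hilbert_le (h : 𝓢(ℝ, ℂ)) : ∃ C, ∀ x, ‖hilbert h x‖ ≤ C := by
  obtain ⟨C, hC, hC'⟩ := h.exists_norm_quot_le
  refine ⟨‖(Real.pi : ℂ)⁻¹‖ * (C * (3 * Real.pi)), fun x => ?_⟩
  unfold hilbert
  rw [norm_mul]
  gcongr
  calc ‖∫ t in Set.Ioi (0 : ℝ), (h (x - t) - h (x + t)) / (t : ℂ)‖
      ≤ ∫ t in Set.Ioi (0 : ℝ), C * quotBound x t := by
        refine norm_integral_le_of_norm_le ((integrable_quotBound x).const_mul C).integrableOn ?_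
        filter_upwards [ae_restrict_mem measurableSet_Ioi] with t ht
        rw [h.norm_quot_eq x ht]
        exact hC' x x t (by simp) ht
    _ ≤ ∫ t, C * quotBound x t :=
        setIntegral_le_integral ((integrable_quotBound x).const_mul C)
          (Eventually.of_forall fun t => mul_nonneg hC (quotBound_nonneg x t))
    _ = C * (3 * Real.pi) := by rw [integral_const_mul, integral_quotBound]

theorem iteratedDeriv_hilbert (n : ℕ) (h : 𝓢(ℝ, ℂ)) :
    iteratedDeriv n (hilbert h) = hilbert ((SchwartzMap.derivCLM ℂ ℂ)^[n] h) := by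
  induction n with
  | zero => simp
  | succ n ih =>
    rw [iteratedDeriv_succ, ih, Function.iterate_succ_apply']
    exact funext fun x => (hasDerivAt_hilbert _ x).deriv

theorem hilbert_hasTemperateGrowth (h : 𝓢(ℝ, ℂ)) : (hilbert h).HasTemperateGrowth := by
  refine ⟨contDiff_of_differentiable_iteratedDeriv fun m _ => ?_, fun n => ?_⟩
  · rw [iteratedDeriv_hilbert]
    exact fun x => (hasDerivAt_hilbert _ x).differentiableAt
  · obtain ⟨C, hC⟩ := exists_norm_hilbert_le ((SchwartzMap.derivCLM ℂ ℂ)^[n] h)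
    refine ⟨0, C, fun x => ?_⟩
    rw [norm_iteratedFDeriv_eq_norm_iteratedDeriv, iteratedDeriv_hilbert]
    simpa using hC x

theorem hilbert_add (a b : 𝓢(ℝ, ℂ)) (x : ℝ) : hilbert (a + b) x = hilbert a x + hilbert b x := by
  unfold hilbert
  rw [← mul_add, ← integral_add (a.integrableOn_quot x) (b.integrableOn_quot x)]
  congr 2
  ext t
  simp only [add_apply]
  ring

theorem hilbert_smul (c : ℂ) (a : 𝓢(ℝ, ℂ)) (x : ℝ) : hilbert (c • a) x = c * hilbert a x := by
  unfold hilbert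
  rw [mul_left_comm, ← integral_const_mul c]
  congr 2
  ext t
  simp only [smul_apply, smul_eq_mul]
  ring

theorem integral_odd_kernel_mul (h : 𝓢(ℝ, ℂ)) {κ : ℝ → ℝ} (hκ : Measurable κ) (hodd : Function.Odd κ)
    {K : ℝ} (hK : ∀ t, |κ t| ≤ K) (x : ℝ) :
    ∫ y, (κ (x - y) : ℂ) * h y
      = ∫ t in Set.Ioi (0 : ℝ), (κ t : ℂ) * (h (x - t) - h (x + t)) := by
  have hint : ∀ {g : ℝ → ℂ}, Integrable g → Integrable fun t => (κ t : ℂ) * g t := fun hg =>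
    hg.bdd_mul (c := K) (Complex.measurable_ofReal.comp hκ).aestronglyMeasurable
      (Eventually.of_forall fun t => by simpa using hK t)
  have i1 := hint (h.integrable.comp_sub_left x)
  have i2 := hint (h.integrable.comp_add_left x)
  have e := integral_sub_left_eq_self (fun t => (κ t : ℂ) * h (x - t)) volume x
  simp only [sub_sub_cancel] at e
  rw [e, ← intervalIntegral.integral_Iic_add_Ioi (b := 0) i1.integrableOn i1.integrableOn]
  have e2 := integral_comp_neg_Ioi 0 (fun t => (κ t : ℂ) * h (x - t))
  rw [neg_zero] at e2
  have e3 : ∀ t, ((κ (-t) : ℝ) : ℂ) * h (x - -t) = -((κ t : ℂ) * h (x + t)) := fun t => by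
    rw [hodd t, sub_neg_eq_add]; push_cast; ring
  simp only [e3, integral_neg] at e2
  rw [← e2]
  simp only [mul_sub]
  rw [integral_sub i1.integrableOn i2.integrableOn]
  ring

theorem SchwartzMap.norm_kernel_mul_le (h : 𝓢(ℝ, ℂ)) {C : ℝ}
    (hC : ∀ x₀ x t, |x - x₀| ≤ 1 → 0 < t →
      ‖h (x - t) - h (x + t)‖ * t⁻¹ ≤ C * quotBound x₀ t)
    {κ : ℝ → ℝ} (hκ : ∀ t, 0 < t → |κ t| ≤ t⁻¹) (x : ℝ) {t : ℝ} (ht : 0 < t) :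
    ‖(κ t : ℂ) * (h (x - t) - h (x + t))‖ ≤ C * quotBound x t := by
  rw [norm_mul, Complex.norm_real, Real.norm_eq_abs, mul_comm]
  exact (mul_le_mul_of_nonneg_left (hκ t ht) (norm_nonneg _)).trans (hC x x t (by simp) ht)

theorem tendsto_integral_odd_kernel_mul (h : 𝓢(ℝ, ℂ)) {κ : ℝ → ℝ → ℝ}
    (hκ : ∀ ε, 0 < ε → Measurable (κ ε)) (hodd : ∀ ε, Function.Odd (κ ε))
    (hK : ∀ ε, 0 < ε → ∃ K, ∀ t, |κ ε t| ≤ K) (hle : ∀ ε t, 0 < t → |κ ε t| ≤ t⁻¹)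
    (hlim : ∀ t, 0 < t → Tendsto (fun ε => κ ε t) (𝓝[>] 0) (𝓝 t⁻¹)) (x : ℝ) :
    Tendsto (fun ε => ∫ y, (κ ε (x - y) : ℂ) * h y) (𝓝[>] 0)
      (𝓝 (Real.pi * hilbert h x)) := by
  obtain ⟨C, hC, hC'⟩ := h.exists_norm_quot_le
  have e : (Real.pi : ℂ) * hilbert h x
      = ∫ t in Set.Ioi (0 : ℝ), ((t⁻¹ : ℝ) : ℂ) * (h (x - t) - h (x + t)) := by
    unfold hilbert
    rw [mul_inv_cancel_left₀ (by exact_mod_cast Real.pi_ne_zero)]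
    congr 1
    ext t
    push_cast
    rw [div_eq_inv_mul]
  rw [e]
  refine Tendsto.congr' (f₁ := fun ε => ∫ t in Set.Ioi (0 : ℝ),
    (κ ε t : ℂ) * (h (x - t) - h (x + t))) ?_ ?_
  · filter_upwards [self_mem_nhdsWithin] with ε hε
    obtain ⟨K, hK⟩ := hK ε hε
    exact (integral_odd_kernel_mul h (hκ ε hε) (hodd ε) hK x).symm
  · refine tendsto_integral_filter_of_dominated_convergence (fun t => C * quotBound x t) ?_ ?_
      ((integrable_quotBound x).const_mul C).integrableOn ?_
    · filter_upwards [self_mem_nhdsWithin] with ε hε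
      have := h.continuous
      exact ((Complex.measurable_ofReal.comp (hκ ε hε)).mul
        (by fun_prop : Continuous fun t => h (x - t) - h (x + t)).measurable).aestronglyMeasurable
    · filter_upwards with ε
      filter_upwards [ae_restrict_mem measurableSet_Ioi] with t ht
      exact h.norm_kernel_mul_le hC' (hle ε) x ht
    · filter_upwards [ae_restrict_mem measurableSet_Ioi] with t ht
      exact ((Complex.continuous_ofReal.tendsto _).comp (hlim t ht)).mul_const _

theorem exists_norm_integral_odd_kernel_mul_le (h : 𝓢(ℝ, ℂ)) :
    ∃ C, ∀ (κ : ℝ → ℝ), Measurable κ → Function.Odd κ → (∃ K, ∀ t, |κ t| ≤ K) →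
      (∀ t, 0 < t → |κ t| ≤ t⁻¹) → ∀ x, ‖∫ y, (κ (x - y) : ℂ) * h y‖ ≤ C := by
  obtain ⟨C, hC, hC'⟩ := h.exists_norm_quot_le
  refine ⟨C * (3 * Real.pi), fun κ hκ hodd ⟨K, hK⟩ hle x => ?_⟩
  rw [integral_odd_kernel_mul h hκ hodd hK x]
  calc _ ≤ ∫ t in Set.Ioi (0 : ℝ), C * quotBound x t := by
        refine norm_integral_le_of_norm_le ((integrable_quotBound x).const_mul C).integrableOn ?_
        filter_upwards [ae_restrict_mem measurableSet_Ioi] with t ht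
        exact h.norm_kernel_mul_le hC' hle x ht
    _ ≤ ∫ t, C * quotBound x t :=
        setIntegral_le_integral ((integrable_quotBound x).const_mul C)
          (Eventually.of_forall fun t => mul_nonneg hC (quotBound_nonneg x t))
    _ = C * (3 * Real.pi) := by rw [integral_const_mul, integral_quotBound]

theorem pvH_eq_hilbert (h : 𝓢(ℝ, ℂ)) (x : ℝ) : pvH h x = hilbert h x := by
  unfold pvH
  refine Tendsto.limUnder_eq ?_
  have key := tendsto_integral_odd_kernel_mul h
    (κ := fun ε => {t : ℝ | ε < |t|}.indicator fun t => t⁻¹) ?_ ?_ ?_ ?_ ?_ x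
  · have := key.const_mul (Real.pi : ℂ)⁻¹
    rw [inv_mul_cancel_left₀ (by exact_mod_cast Real.pi_ne_zero)] at this
    refine this.congr fun ε => ?_
    rw [← integral_indicator (measurableSet_lt (by fun_prop) (by fun_prop))]
    congr 2
    ext y
    by_cases hy : ε < |x - y|
    · simp [Set.indicator, hy, div_eq_inv_mul]
    · simp [Set.indicator, hy]
  · exact fun ε _ => measurable_inv.indicator (measurableSet_lt (by fun_prop) (by fun_prop))
  · intro ε t
    by_cases ht : ε < |t|
    · simp [Set.indicator, ht, inv_neg]
    · simp [Set.indicator, ht]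
  · refine fun ε hε => ⟨ε⁻¹, fun t => ?_⟩
    by_cases ht : ε < |t|
    · simp only [Set.indicator, Set.mem_ofPred_eq, ht, if_true, abs_inv]
      exact inv_anti₀ hε ht.le
    · simp [Set.indicator, ht, hε.le]
  · intro ε t ht0
    by_cases ht : ε < t
    · simp [Set.indicator, ht, abs_of_pos ht0]
    · simp [Set.indicator, ht, abs_of_pos ht0, ht0.le]
  · intro t ht
    refine tendsto_const_nhds.congr' ?_
    filter_upwards [Ioo_mem_nhdsGT ht] with ε hε
    simp [Set.indicator, abs_of_pos ht, hε.2]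

/-- The conjugate Poisson kernel, without the factor `π⁻¹`. -/
noncomputable def conjKernel (ε t : ℝ) : ℝ := t / (t ^ 2 + ε ^ 2)

theorem continuous_conjKernel {ε : ℝ} (hε : 0 < ε) : Continuous (conjKernel ε) := by
  unfold conjKernel
  exact continuous_id.div (by fun_prop) fun t => by positivity

theorem conjKernel_odd (ε : ℝ) : Function.Odd (conjKernel ε) := fun t => by
  unfold conjKernel; rw [neg_sq, neg_div]

theorem abs_conjKernel_le {ε : ℝ} (hε : 0 < ε) (t : ℝ) : |conjKernel ε t| ≤ ε⁻¹ := by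
  unfold conjKernel
  rw [abs_div, abs_of_pos (by positivity : 0 < t ^ 2 + ε ^ 2), div_le_iff₀ (by positivity),
    ← div_eq_inv_mul, le_div_iff₀ hε, ← sq_abs t]
  nlinarith [sq_nonneg (|t| - ε), sq_nonneg |t|, mul_nonneg (abs_nonneg t) hε.le]

theorem abs_conjKernel_le_inv (ε : ℝ) {t : ℝ} (ht : 0 < t) : |conjKernel ε t| ≤ t⁻¹ := by
  unfold conjKernel
  rw [abs_div, abs_of_pos (by positivity : 0 < t ^ 2 + ε ^ 2), abs_of_pos ht,
    div_le_iff₀ (by positivity), ← div_eq_inv_mul, le_div_iff₀ ht]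
  nlinarith [sq_nonneg ε]

theorem tendsto_conjKernel {t : ℝ} (ht : t ≠ 0) :
    Tendsto (fun ε => conjKernel ε t) (𝓝[>] 0) (𝓝 t⁻¹) := by
  have : ContinuousAt (fun ε => conjKernel ε t) 0 := by
    unfold conjKernel
    exact continuousAt_const.div (by fun_prop) (by positivity)
  have h := this.tendsto.mono_left (nhdsWithin_le_nhds (s := Set.Ioi 0))
  convert h using 2
  unfold conjKernel
  field_simp
  ring

theorem tendsto_integral_conjKernel_mul (h : 𝓢(ℝ, ℂ)) (x : ℝ) :
    Tendsto (fun ε => ∫ y, (conjKernel ε (x - y) : ℂ) * h y) (𝓝[>] 0)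
      (𝓝 (Real.pi * hilbert h x)) :=
  tendsto_integral_odd_kernel_mul h (fun _ hε => (continuous_conjKernel hε).measurable)
    conjKernel_odd (fun _ hε => ⟨_, abs_conjKernel_le hε⟩) (fun ε _ => abs_conjKernel_le_inv ε)
    (fun _ ht => tendsto_conjKernel ht.ne') x

theorem tendsto_integral_poissonKernel_mul (h : 𝓢(ℝ, ℂ)) (x : ℝ) :
    Tendsto (fun ε : ℝ => ∫ y, ((ε / ((x - y) ^ 2 + ε ^ 2) : ℝ) : ℂ) * h y) (𝓝[>] 0)
      (𝓝 (Real.pi * h x)) := by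
  have hc := h.continuous
  have e : ∀ ε > 0, ∫ y, ((ε / ((x - y) ^ 2 + ε ^ 2) : ℝ) : ℂ) * h y
      = ∫ u, (((1 + u ^ 2)⁻¹ : ℝ) : ℂ) * h (x - ε * u) := by
    intro ε hε
    have e1 := integral_sub_left_eq_self
      (fun t => ((ε / (t ^ 2 + ε ^ 2) : ℝ) : ℂ) * h (x - t)) volume x
    simp only [sub_sub_cancel] at e1
    have e2 := Measure.integral_comp_mul_left
      (fun t => ((ε / (t ^ 2 + ε ^ 2) : ℝ) : ℂ) * h (x - t)) ε
    rw [abs_of_pos (inv_pos.2 hε), Complex.real_smul, eq_comm,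
      Complex.ofReal_inv, inv_mul_eq_iff_eq_mul₀ (by exact_mod_cast hε.ne')] at e2
    rw [e1, e2, ← integral_const_mul]
    congr 1
    ext u
    rw [← mul_assoc, ← Complex.ofReal_mul]
    congr 2
    have : (1 + u ^ 2) ≠ 0 := by positivity
    field_simp
    ring
  have e3 : (Real.pi : ℂ) * h x = ∫ u : ℝ, (((1 + u ^ 2)⁻¹ : ℝ) : ℂ) * h x := by
    rw [integral_mul_const, integral_complex_ofReal, integral_univ_inv_one_add_sq]
  rw [e3]
  refine Tendsto.congr' (f₁ := fun ε => ∫ u, (((1 + u ^ 2)⁻¹ : ℝ) : ℂ) * h (x - ε * u)) ?_ ?_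
  · filter_upwards [self_mem_nhdsWithin] with ε hε using (e ε hε).symm
  · refine tendsto_integral_filter_of_dominated_convergence
      (fun u => (1 + u ^ 2)⁻¹ * SchwartzMap.seminorm ℝ 0 0 h) ?_ ?_
      (integrable_inv_one_add_sq.mul_const _) ?_
    · filter_upwards with ε
      have : Continuous fun u : ℝ => (1 + u ^ 2)⁻¹ :=
        Continuous.inv₀ (by fun_prop) fun u => by positivity
      exact Continuous.aestronglyMeasurable (by fun_prop)
    · filter_upwards with ε
      filter_upwards with u
      rw [norm_mul, Complex.norm_real, Real.norm_of_nonneg (by positivity)]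
      gcongr
      exact SchwartzMap.norm_le_seminorm ℝ h _
    · filter_upwards with u
      refine Tendsto.const_mul _ ?_
      have : Continuous fun ε : ℝ => h (x - ε * u) := by fun_prop
      simpa using (this.tendsto 0).mono_left (nhdsWithin_le_nhds (s := Set.Ioi 0))

theorem abs_mul_conjKernel_le (ε t : ℝ) : |t * conjKernel ε t| ≤ 1 := by
  unfold conjKernel
  rcases eq_or_ne t 0 with rfl | ht
  · simp
  · rw [← mul_div_assoc, ← sq, abs_of_nonneg (by positivity), div_le_one (by positivity)]
    nlinarith [sq_nonneg ε]

theorem integrable_mul_of_bounded {k : ℝ → ℂ} (hk : Continuous k) {K : ℝ} (hK : ∀ s, ‖k s‖ ≤ K)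
    {a : ℝ → ℂ} (ha : Integrable a) : Integrable fun s => k s * a s :=
  ha.bdd_mul (c := K) hk.aestronglyMeasurable (Eventually.of_forall hK)

theorem ae_fst_ne_snd : ∀ᵐ p : ℝ × ℝ ∂(volume.prod volume), p.1 ≠ p.2 := by
  have hm : MeasurableSet {p : ℝ × ℝ | p.1 = p.2} := measurableSet_eq_fun (by fun_prop) (by fun_prop)
  have h0 : (volume.prod volume) {p : ℝ × ℝ | p.1 = p.2} = 0 := by
    rw [Measure.measure_prod_null hm]
    filter_upwards with s
    have : Prod.mk s ⁻¹' {p : ℝ × ℝ | p.1 = p.2} = {s} := by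
      ext t; simp [eq_comm]
    simp [this]
  simpa [ae_iff] using h0

theorem tendsto_integral_mul_conjKernel (a : 𝓢(ℝ, ℂ)) {b : ℝ → ℂ} (hb : Continuous b)
    (hbi : Integrable b) :
    Tendsto (fun δ => ∫ s, b s * ∫ t, (conjKernel δ (s - t) : ℂ) * a t) (𝓝[>] 0)
      (𝓝 (∫ s, b s * (Real.pi * hilbert a s))) := by
  obtain ⟨C, hC⟩ := exists_norm_integral_odd_kernel_mul_le a
  refine tendsto_integral_filter_of_dominated_convergence (fun s => ‖b s‖ * C) ?_ ?_
    (hbi.norm.mul_const _) ?_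
  · filter_upwards [self_mem_nhdsWithin] with δ hδ
    refine hb.aestronglyMeasurable.mul ?_
    have h1 := continuous_conjKernel hδ
    have h2 := a.continuous
    have h3 : Continuous fun p : ℝ × ℝ => (conjKernel δ (p.1 - p.2) : ℂ) * a p.2 := by fun_prop
    exact (h3.stronglyMeasurable.integral_prod_right (ν := volume)).aestronglyMeasurable
  · filter_upwards [self_mem_nhdsWithin] with δ hδ
    filter_upwards with s
    rw [norm_mul]
    gcongr
    exact hC _ (continuous_conjKernel hδ).measurable (conjKernel_odd δ) ⟨_, abs_conjKernel_le hδ⟩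
      (fun t => abs_conjKernel_le_inv δ) s
  · filter_upwards with s
    exact (tendsto_integral_conjKernel_mul a s).const_mul _

theorem integral_mul_integral_of_resolvent (a g : 𝓢(ℝ, ℂ)) {k : ℝ → ℂ} (hk : Continuous k) {K : ℝ}
    (hK : ∀ s, ‖k s‖ ≤ K) (hres : ∀ s t : ℝ, k s * k t * ((s - t : ℝ) : ℂ) = k s - k t) :
    (∫ s, k s * a s) * (∫ t, k t * g t)
      = (∫ s, k s * a s * (Real.pi * hilbert g s))
        + ∫ s, k s * g s * (Real.pi * hilbert a s) := by
  have ha := a.continuous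
  have hg := g.continuous
  have ia := integrable_mul_of_bounded hk hK (a.integrable (μ := volume))
  have ig := integrable_mul_of_bounded hk hK (g.integrable (μ := volume))
  set F : ℝ → ℝ × ℝ → ℂ := fun δ p =>
    (((p.1 - p.2) * conjKernel δ (p.1 - p.2) : ℝ) : ℂ) * ((k p.1 * a p.1) * (k p.2 * g p.2)) with hF
  have lim1 : Tendsto (fun δ => ∫ p, F δ p ∂(volume.prod volume)) (𝓝[>] 0)
      (𝓝 ((∫ s, k s * a s) * (∫ t, k t * g t))) := by
    rw [← integral_prod_mul]
    refine tendsto_integral_filter_of_dominated_convergence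
      (fun p => ‖(k p.1 * a p.1) * (k p.2 * g p.2)‖) ?_ ?_ (ia.mul_prod ig).norm ?_
    · filter_upwards [self_mem_nhdsWithin] with δ hδ
      have h1 := continuous_conjKernel hδ
      exact Continuous.aestronglyMeasurable (by fun_prop)
    · filter_upwards with δ
      filter_upwards with p
      rw [hF, norm_mul, Complex.norm_real, Real.norm_eq_abs]
      exact mul_le_of_le_one_left (norm_nonneg _) (abs_mul_conjKernel_le _ _)
    · filter_upwards [ae_fst_ne_snd] with p hp
      have h0 : p.1 - p.2 ≠ 0 := sub_ne_zero.2 hp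
      have h1 := (tendsto_conjKernel h0).const_mul (p.1 - p.2)
      rw [mul_inv_cancel₀ h0] at h1
      simpa [F] using ((Complex.continuous_ofReal.tendsto _).comp h1).mul_const
        ((k p.1 * a p.1) * (k p.2 * g p.2))
  have lim2 := (tendsto_integral_mul_conjKernel g (b := fun s => k s * a s) (hk.mul ha) ia).add
    (tendsto_integral_mul_conjKernel a (b := fun s => k s * g s) (hk.mul hg) ig)
  refine tendsto_nhds_unique (lim1.congr' ?_) lim2
  filter_upwards [self_mem_nhdsWithin] with δ hδ
  have h1 := continuous_conjKernel hδ
  have hb : ∀ {u : ℝ × ℝ → ℂ}, Integrable u (volume.prod volume) →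
      Integrable (fun p : ℝ × ℝ => (conjKernel δ (p.1 - p.2) : ℂ) * u p) (volume.prod volume) :=
    fun hu => hu.bdd_mul (c := δ⁻¹)
      (Continuous.aestronglyMeasurable (by fun_prop))
      (Eventually.of_forall fun p => by simpa using abs_conjKernel_le hδ (p.1 - p.2))
  have i1 := hb (ia.mul_prod (g.integrable (μ := volume)))
  have i2 := hb ((a.integrable (μ := volume)).mul_prod ig)
  have e : ∀ p, F δ p = (conjKernel δ (p.1 - p.2) : ℂ) * ((k p.1 * a p.1) * g p.2)
      - (conjKernel δ (p.1 - p.2) : ℂ) * (a p.1 * (k p.2 * g p.2)) := fun p => by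
    have := hres p.1 p.2
    simp only [hF]
    rw [Complex.ofReal_mul]
    linear_combination (conjKernel δ (p.1 - p.2) : ℂ) * a p.1 * g p.2 * this
  simp only [e]
  rw [integral_sub i1 i2, integral_prod _ i1, integral_prod_symm _ i2, sub_eq_add_neg,
    ← integral_neg]
  congr 1
  · congr 1
    ext s
    rw [← integral_const_mul]
    congr 1
    ext t
    ring
  · congr 1
    ext s
    rw [← integral_const_mul, ← integral_neg]
    congr 1
    ext t
    rw [← neg_sub s t, conjKernel_odd]
    push_cast
    ring

/-- Multiplication of a Schwartz function by the Hilbert transform of another one. -/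
noncomputable def mulHilbert (a h : 𝓢(ℝ, ℂ)) : 𝓢(ℝ, ℂ) :=
  SchwartzMap.smulLeftCLM ℂ (hilbert h) a

theorem mulHilbert_apply (a h : 𝓢(ℝ, ℂ)) (x : ℝ) : mulHilbert a h x = a x * hilbert h x := by
  rw [mulHilbert, SchwartzMap.smulLeftCLM_apply_apply (hilbert_hasTemperateGrowth h), smul_eq_mul,
    mul_comm]

theorem tendsto_integral_resolvent_mul (h : 𝓢(ℝ, ℂ)) (x : ℝ) :
    Tendsto (fun ε : ℝ => ∫ y, (((x - y : ℝ) : ℂ) + ε * Complex.I)⁻¹ * h y) (𝓝[>] 0)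
      (𝓝 (Real.pi * (hilbert h x - Complex.I * h x))) := by
  have key := (tendsto_integral_conjKernel_mul h x).sub
    ((tendsto_integral_poissonKernel_mul h x).const_mul Complex.I)
  rw [show (Real.pi : ℂ) * hilbert h x - Complex.I * (Real.pi * h x)
    = Real.pi * (hilbert h x - Complex.I * h x) by ring] at key
  refine key.congr' ?_
  filter_upwards [self_mem_nhdsWithin] with ε hε
  have hε' : (0 : ℝ) < ε := hε
  have bdd : ∀ y, |ε / ((x - y) ^ 2 + ε ^ 2)| ≤ ε⁻¹ := fun y => by
    rw [abs_of_nonneg (by positivity), div_le_iff₀ (by positivity), ← div_eq_inv_mul,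
      le_div_iff₀ hε']
    nlinarith [sq_nonneg (x - y)]
  have cont : Continuous fun y => ε / ((x - y) ^ 2 + ε ^ 2) :=
    continuous_const.div (by fun_prop) fun y => by positivity
  have hc := continuous_conjKernel hε'
  have i1 := integrable_mul_of_bounded (k := fun y => (conjKernel ε (x - y) : ℂ)) (by fun_prop)
    (fun y => by simpa using abs_conjKernel_le hε' (x - y)) (h.integrable (μ := volume))
  have i2 := integrable_mul_of_bounded (k := fun y => ((ε / ((x - y) ^ 2 + ε ^ 2) : ℝ) : ℂ))
    (by fun_prop) (fun y => by rw [Complex.norm_real]; exact bdd y) (h.integrable (μ := volume))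
  rw [← integral_const_mul, ← integral_sub i1 (i2.const_mul _)]
  congr 1
  ext y
  have hz : ((x - y : ℝ) : ℂ) + ε * Complex.I ≠ 0 := fun h0 => by
    have := congrArg Complex.im h0
    simp at this
    exact hε'.ne' this
  have hd : (((x - y) ^ 2 + ε ^ 2 : ℝ) : ℂ) ≠ 0 := by
    exact_mod_cast (by positivity : (x - y) ^ 2 + ε ^ 2 ≠ 0)
  have hinv : (((x - y : ℝ) : ℂ) + ε * Complex.I)⁻¹
      = (((x - y : ℝ) : ℂ) - ε * Complex.I) / (((x - y) ^ 2 + ε ^ 2 : ℝ) : ℂ) := by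
    rw [eq_div_iff hd, inv_mul_eq_iff_eq_mul₀ hz]
    push_cast
    linear_combination (ε : ℂ) ^ 2 * Complex.I_sq
  rw [hinv]
  unfold conjKernel
  rw [Complex.ofReal_div, Complex.ofReal_div]
  ring

/-- The Cotlar identity for the Hilbert transform. -/
theorem hilbert_mulHilbert_add (a g : 𝓢(ℝ, ℂ)) (x : ℝ) :
    hilbert (mulHilbert a g) x + hilbert (mulHilbert g a) x
      = hilbert a x * hilbert g x - a x * g x := by
  have hπ : (Real.pi : ℂ) ≠ 0 := by exact_mod_cast Real.pi_ne_zero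
  have lim1 := (tendsto_integral_resolvent_mul a x).mul (tendsto_integral_resolvent_mul g x)
  have lim2 := ((tendsto_integral_resolvent_mul (mulHilbert a g) x).add
    (tendsto_integral_resolvent_mul (mulHilbert g a) x)).const_mul (Real.pi : ℂ)
  have := tendsto_nhds_unique_of_eventuallyEq lim1 lim2 ?_
  · simp only [mulHilbert_apply] at this
    refine mul_left_cancel₀ (mul_ne_zero hπ hπ) ?_
    linear_combination -this + (Real.pi : ℂ) ^ 2 * a x * g x * Complex.I_sq
  · filter_upwards [self_mem_nhdsWithin] with ε hε
    have hε' : (0 : ℝ) < ε := hε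
    have hz : ∀ y : ℝ, ((x - y : ℝ) : ℂ) + ε * Complex.I ≠ 0 := fun y h0 => by
      have := congrArg Complex.im h0
      simp at this
      exact hε'.ne' this
    rw [integral_mul_integral_of_resolvent a g (K := ε⁻¹)
      (k := fun y : ℝ => (((x - y : ℝ) : ℂ) + ε * Complex.I)⁻¹)
      (Continuous.inv₀ (by fun_prop) hz), mul_add, ← integral_const_mul, ← integral_const_mul]
    · simp only [mulHilbert_apply]
      congr 1 <;> congr 1 <;> ext s <;> ring
    · intro s
      rw [norm_inv]
      refine inv_anti₀ hε' ?_
      have := Complex.abs_im_le_norm (((x - s : ℝ) : ℂ) + ε * Complex.I)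
      simpa [abs_of_pos hε'] using this
    · intro s t
      have h1 := hz s
      have h2 := hz t
      rw [inv_sub_inv h1 h2, ← mul_inv, inv_mul_eq_div]
      congr 1
      push_cast
      ring

theorem hilbert_neg (a : 𝓢(ℝ, ℂ)) (x : ℝ) : hilbert (-a) x = -hilbert a x := by
  rw [← neg_one_smul ℂ a, hilbert_smul, neg_one_mul]

theorem hilbert_sub (a b : 𝓢(ℝ, ℂ)) (x : ℝ) : hilbert (a - b) x = hilbert a x - hilbert b x := by
  rw [sub_eq_add_neg, hilbert_add, hilbert_neg, sub_eq_add_neg]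

/-- The complex conjugate of a Schwartz function. -/
noncomputable def SchwartzMap.conj (v : 𝓢(ℝ, ℂ)) : 𝓢(ℝ, ℂ) :=
  SchwartzMap.postcompCLM (𝕜 := ℝ) (Complex.conjCLE : ℂ →L[ℝ] ℂ) v

theorem SchwartzMap.conj_apply (v : 𝓢(ℝ, ℂ)) (x : ℝ) : v.conj x = conj (v x) := rfl

/-- The pointwise product of two Schwartz functions. -/
noncomputable def SchwartzMap.mul (a b : 𝓢(ℝ, ℂ)) : 𝓢(ℝ, ℂ) :=
  SchwartzMap.smulLeftCLM ℂ a b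

theorem SchwartzMap.mul_apply (a b : 𝓢(ℝ, ℂ)) (x : ℝ) : a.mul b x = a x * b x := by
  rw [SchwartzMap.mul, SchwartzMap.smulLeftCLM_apply_apply a.hasTemperateGrowth, smul_eq_mul]

/-- The derivative of a Schwartz function. -/
noncomputable def SchwartzMap.D (a : 𝓢(ℝ, ℂ)) : 𝓢(ℝ, ℂ) := SchwartzMap.derivCLM ℂ ℂ a

theorem SchwartzMap.coe_D (a : 𝓢(ℝ, ℂ)) : ⇑a.D = deriv a := rfl

theorem SchwartzMap.hasDerivAt_D (a : 𝓢(ℝ, ℂ)) (x : ℝ) : HasDerivAt a (a.D x) x := a.hasDerivAt x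

theorem SchwartzMap.D_add (a b : 𝓢(ℝ, ℂ)) : (a + b).D = a.D + b.D := map_add _ a b

theorem SchwartzMap.D_sub (a b : 𝓢(ℝ, ℂ)) : (a - b).D = a.D - b.D := map_sub _ a b

theorem SchwartzMap.D_neg (a : 𝓢(ℝ, ℂ)) : (-a).D = -a.D := map_neg _ a

theorem SchwartzMap.D_smul (c : ℂ) (a : 𝓢(ℝ, ℂ)) : (c • a).D = c • a.D := map_smul _ c a

theorem SchwartzMap.D_mul (a b : 𝓢(ℝ, ℂ)) : (a.mul b).D = a.D.mul b + a.mul b.D := by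
  ext x
  rw [add_apply, mul_apply, mul_apply]
  refine ((a.mul b).hasDerivAt_D x).unique ?_
  refine ((a.hasDerivAt_D x).mul (b.hasDerivAt_D x)).congr_of_eventuallyEq ?_
  exact Eventually.of_forall fun y => mul_apply a b y

theorem SchwartzMap.D_mulHilbert (a h : 𝓢(ℝ, ℂ)) :
    (mulHilbert a h).D = mulHilbert a.D h + mulHilbert a h.D := by
  ext x
  rw [add_apply, mulHilbert_apply, mulHilbert_apply]
  refine ((mulHilbert a h).hasDerivAt_D x).unique ?_
  refine ((a.hasDerivAt_D x).mul (hasDerivAt_hilbert h x)).congr_of_eventuallyEq ?_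
  exact Eventually.of_forall fun y => mulHilbert_apply a h y

theorem SchwartzMap.D_conj (a : 𝓢(ℝ, ℂ)) : a.conj.D = a.D.conj := by
  ext x
  exact (a.conj.hasDerivAt_D x).unique
    (Complex.conjCLE.hasFDerivAt.comp_hasDerivAt x (a.hasDerivAt_D x))

theorem conj_hilbert (a : 𝓢(ℝ, ℂ)) (x : ℝ) : conj (hilbert a x) = hilbert a.conj x := by
  unfold hilbert
  rw [map_mul, ← integral_conj]
  simp [SchwartzMap.conj_apply]

theorem SchwartzMap.coe_conj_mul (v f : 𝓢(ℝ, ℂ)) :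
    ⇑(v.conj.mul f) = fun y => conj (v y) * f y := by
  ext y
  rw [mul_apply, conj_apply]

theorem DtV_eq (v f : 𝓢(ℝ, ℂ)) :
    DtV v f = ⇑(f.D + (1 / 2 : ℂ) • mulHilbert v (v.conj.mul f)) := by
  ext x
  have e := (SchwartzMap.coe_conj_mul v f).symm
  simp only [DtV, e, pvH_eq_hilbert, add_apply, smul_apply, smul_eq_mul, mulHilbert_apply,
    SchwartzMap.coe_D]
  ring

theorem HV_eq (v f : 𝓢(ℝ, ℂ)) :
    HV v f = ⇑(-f.D.D + (1 / 4 : ℂ) • (v.mul v.conj).mul ((v.mul v.conj).mul f)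
      - mulHilbert v (v.conj.mul f).D) := by
  ext x
  have e := (SchwartzMap.coe_conj_mul v f).symm
  have e4 : ((‖v x‖ ^ 4 : ℝ) : ℂ) = (v x * conj (v x)) * (v x * conj (v x)) := by
    rw [Complex.mul_conj, Complex.normSq_eq_norm_sq]
    push_cast
    ring
  simp only [HV, e, e4, ← SchwartzMap.coe_D, pvH_eq_hilbert, add_apply, neg_apply, sub_apply,
    smul_apply, smul_eq_mul, mulHilbert_apply, SchwartzMap.mul_apply, SchwartzMap.conj_apply]
  ring

/-- The algebraic commutator identity underlying the unconditional Lax pair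
`∂ₜ(−i𝐃̃_v) = [−iH_v, −i𝐃̃_v]` for the gauged Calogero–Moser DNLS:
`2𝐃̃_v(H_v f) − 2H_v(𝐃̃_v f) = −(H_v v)·H(conj(v) f) + v·H(conj(H_v v) f)` pointwise. -/
theorem stmt10 (v f : SchwartzMap ℝ ℂ) : ∀ x : ℝ,
    2 * DtV (fun y => v y) (HV (fun y => v y) (fun y => f y)) x
        - 2 * HV (fun y => v y) (DtV (fun y => v y) (fun y => f y)) x
      = -HV (fun y => v y) (fun y => v y) x * pvH (fun y => (starRingEnd ℂ) (v y) * f y) x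
        + v x * pvH (fun y =>
            (starRingEnd ℂ) (HV (fun z => v z) (fun z => v z) y) * f y) x := by
  intro x
  set w := v.conj with hw
  set m := v.mul w with hm
  set g := w.mul f with hg
  have e1 : (fun y => conj (v y) * f y) = ⇑g := (SchwartzMap.coe_conj_mul v f).symm
  have hwm : w.mul v = m := by
    ext y; simp only [hm, SchwartzMap.mul_apply]; ring
  have e2 : (fun y => conj (HV v v y) * f y)
      = ⇑(-w.D.D.mul f + (1 / 4 : ℂ) • m.mul (m.mul g) - mulHilbert g m.D) := by
    ext y
    have hmc : m.D.conj = m.D := by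
      rw [← SchwartzMap.D_conj]
      congr 1
      ext y
      simp only [hm, hw, SchwartzMap.conj_apply, SchwartzMap.mul_apply, map_mul, Complex.conj_conj]
      ring
    have hwd : v.conj.D.D y = conj (v.D.D y) := by
      rw [SchwartzMap.D_conj, SchwartzMap.D_conj, SchwartzMap.conj_apply]
    rw [HV_eq, hwm]
    simp only [add_apply, neg_apply, sub_apply, smul_apply, smul_eq_mul, mulHilbert_apply,
      SchwartzMap.mul_apply, map_sub, map_add, map_neg, map_mul, map_div₀, map_one, map_ofNat,
      conj_hilbert, hwd, hm, hg, hw, SchwartzMap.conj_apply,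
      Complex.conj_conj]
    rw [← hw, ← hm, hmc]
    ring
  change 2 * DtV v (HV v f) x - 2 * HV v (DtV v f) x
    = -HV v v x * pvH (fun y => conj (v y) * f y) x + v x * pvH (fun y => conj (HV v v y) * f y) x
  rw [e1, e2, pvH_eq_hilbert, pvH_eq_hilbert, HV_eq v f, DtV_eq v f, DtV_eq, HV_eq, HV_eq, hwm]
  have a1 : w.mul (-f.D.D + (1 / 4 : ℂ) • m.mul (m.mul f) - mulHilbert v g.D)
      = -w.mul f.D.D + (1 / 4 : ℂ) • m.mul (m.mul g) - mulHilbert m g.D := by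
    ext y
    simp only [add_apply, neg_apply, sub_apply, smul_apply, smul_eq_mul, mulHilbert_apply,
      SchwartzMap.mul_apply, hm, hg]
    ring
  have a2 : w.mul (f.D + (1 / 2 : ℂ) • mulHilbert v g)
      = w.mul f.D + (1 / 2 : ℂ) • mulHilbert m g := by
    ext y
    simp only [add_apply, smul_apply, smul_eq_mul, mulHilbert_apply, SchwartzMap.mul_apply, hm]
    ring
  have cot := hilbert_mulHilbert_add m.D g x
  have dg : g.D = w.D.mul f + w.mul f.D := SchwartzMap.D_mul w f
  have dm : m.D x = v.D x * w x + v x * w.D x := by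
    simp only [hm, SchwartzMap.D_mul, add_apply, SchwartzMap.mul_apply]
  have vg : g x = w x * f x := SchwartzMap.mul_apply _ _ _
  rw [a1, a2]
  simp only [SchwartzMap.D_add, SchwartzMap.D_sub, SchwartzMap.D_neg, SchwartzMap.D_smul,
    SchwartzMap.D_mul, SchwartzMap.D_mulHilbert, add_apply, neg_apply, sub_apply, smul_apply,
    smul_eq_mul, mulHilbert_apply, SchwartzMap.mul_apply, hilbert_add, hilbert_sub, hilbert_neg,
    hilbert_smul, dg] at cot ⊢
  linear_combination v x * cot - v x * g x * dm - v x * (v.D x * w x + v x * w.D x) * vg
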